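/- arXiv:2501.07035 — 5 statements merged into one kernel-verified Lean document; each statement's English description precedes it below -/
import Mathlib

section
/- With H defined as in the context, if μ > 0, ν ∈ (0,1), and both B and C have full column rank (equivalently, the linear maps x ↦ Bx and y ↦ Cy are injective), then H is a symmetric positive definite matrix. -/
open Matrix

theorem aux_diag {m n : Type*} [Fintype m] [Fintype n] {A : Matrix m m ℝ} {D : Matrix n n ℝ}
    (hA : A.PosDef) (hD : D.PosDef) : (Matrix.fromBlocks A 0 0 D).PosDef := by
  refine Matrix.PosDef.of_dotProduct_mulVec_pos
    (Matrix.IsHermitian.fromBlocks hA.1 (by simp) hD.1) fun x hx => ?_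
  obtain ⟨u, v, rfl⟩ : ∃ u v, x = Sum.elim u v := ⟨x ∘ Sum.inl, x ∘ Sum.inr, by simp⟩
  have h1 : star (Sum.elim u v) ⬝ᵥ (Matrix.fromBlocks A 0 0 D *ᵥ Sum.elim u v)
      = star u ⬝ᵥ (A *ᵥ u) + star v ⬝ᵥ (D *ᵥ v) := by
    simp [Matrix.fromBlocks_mulVec, dotProduct]
  rw [h1]
  by_cases hu : u = 0
  · have hv : v ≠ 0 := by
      rintro rfl
      apply hx
      subst hu
      ext i
      cases i <;> rfl
    exact add_pos_of_nonneg_of_pos (hA.posSemidef.dotProduct_mulVec_nonneg u)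
      (hD.dotProduct_mulVec_pos hv)
  · exact add_pos_of_pos_of_nonneg (hA.dotProduct_mulVec_pos hu)
      (hD.posSemidef.dotProduct_mulVec_nonneg v)

/-- If `μ > 0`, `ν ∈ (0,1)`, `BᵀB` is invertible and both `B` and `C` have full
column rank, then the weighting matrix `H` of QPADM-slack(GB) is symmetric
positive definite. -/
theorem stmt_4 {r s t : ℕ} (μ ν : ℝ) (hμ : 0 < μ) (hν : ν ∈ Set.Ioo (0 : ℝ) 1)
    (B : Matrix (Fin r) (Fin s) ℝ) (C : Matrix (Fin r) (Fin t) ℝ)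
    (hBB : IsUnit (Bᵀ * B))
    (hB : Function.Injective B.mulVec) (hC : Function.Injective C.mulVec) :
    let H : Matrix ((Fin s ⊕ Fin t) ⊕ Fin r) ((Fin s ⊕ Fin t) ⊕ Fin r) ℝ :=
      Matrix.fromBlocks
        (Matrix.fromBlocks ((μ / ν) • (Bᵀ * B)) ((μ / ν) • (Bᵀ * C))
          ((μ / ν) • (Cᵀ * B))
          ((μ / ν) • (Cᵀ * C + Cᵀ * B * (Bᵀ * B)⁻¹ * (Bᵀ * C))))
        0
        0
        (μ⁻¹ • (1 : Matrix (Fin r) (Fin r) ℝ))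
    H.IsSymm ∧ H.PosDef := by
  intro H
  suffices hH : H.PosDef by
    refine ⟨?_, hH⟩
    have := hH.1
    rwa [Matrix.IsHermitian, Matrix.conjTranspose_eq_transpose_of_trivial] at this
  have hc : 0 < μ / ν := div_pos hμ hν.1
  have hdet : IsUnit (Bᵀ * B).det := (Matrix.isUnit_iff_isUnit_det _).1 hBB
  refine aux_diag ?_ (Matrix.PosDef.one.smul (inv_pos.2 hμ))
  rw [← Matrix.fromBlocks_smul]
  refine Matrix.PosDef.smul ?_ hc
  set P : Matrix (Fin s) (Fin t) ℝ := (Bᵀ * B)⁻¹ * (Bᵀ * C) with hP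
  have h1 : Bᵀ * B * P = Bᵀ * C := Matrix.mul_nonsing_inv_cancel_left _ _ hdet
  have h2 : Pᵀ * (Bᵀ * B) = Cᵀ * B := by
    have := congrArg Matrix.transpose h1
    simpa [Matrix.transpose_mul] using this
  have key : Matrix.fromBlocks (Bᵀ * B) (Bᵀ * C) (Cᵀ * B)
      (Cᵀ * C + Cᵀ * B * (Bᵀ * B)⁻¹ * (Bᵀ * C))
      = (Matrix.fromBlocks B (B * P) 0 C)ᴴ * Matrix.fromBlocks B (B * P) 0 C := by
    rw [Matrix.conjTranspose_eq_transpose_of_trivial, Matrix.fromBlocks_transpose,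
      Matrix.fromBlocks_multiply]
    congr 1
    · simp
    · simp [← Matrix.mul_assoc, h1]
    · simp [Matrix.transpose_mul, Matrix.mul_assoc, h2]
    · rw [Matrix.transpose_mul, Matrix.mul_assoc Pᵀ, ← Matrix.mul_assoc Bᵀ, ← Matrix.mul_assoc Pᵀ,
        h2, add_comm, Matrix.mul_assoc (Cᵀ * B)]
  rw [key]
  apply Matrix.PosDef.conjTranspose_mul_self
  rw [← Matrix.coe_mulVecLin, ← LinearMap.ker_eq_bot, LinearMap.ker_eq_bot']
  intro x hx
  obtain ⟨u, v, rfl⟩ : ∃ u v, x = Sum.elim u v := ⟨x ∘ Sum.inl, x ∘ Sum.inr, by simp⟩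
  rw [Matrix.mulVecLin_apply, Matrix.fromBlocks_mulVec] at hx
  have e2 : C *ᵥ v = 0 := by
    ext i
    simpa using congrFun hx (Sum.inr i)
  have hv : v = 0 := hC (by simpa using e2)
  subst hv
  have e1 : B *ᵥ u = 0 := by
    ext i
    simpa using congrFun hx (Sum.inl i)
  have hu : u = 0 := hB (by simpa using e1)
  subst hu
  ext i
  cases i <;> rfl
end

section
/- Let H ∈ ℝ^{d×d} be symmetric and M ∈ ℝ^{d×d} be any matrix; set Q := H M and G := (Qᵀ + Q) − Mᵀ H M. Let g_c, g̃ ∈ ℝ^d and define the corrected point g_n := g_c − M(g_c − g̃). Then for every g ∈ ℝ^d: (g − g̃)ᵀ Q (g_c − g̃) = ½ (‖g − g_n‖²_H − ‖g − g_c‖²_H) + ½ ‖g_c − g̃‖²_G. -/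
open Matrix

/-- Combined identity (A.24)–(A.27): with `H` symmetric, `Q := H M`,
`G := (Qᵀ + Q) − Mᵀ H M`, and corrected point `g_n := g_c − M (g_c − g̃)`,
for every `g`:
`(g − g̃)ᵀ Q (g_c − g̃) = ½ (‖g − g_n‖²_H − ‖g − g_c‖²_H) + ½ ‖g_c − g̃‖²_G`. -/
theorem stmt_8 {d : ℕ} (H M : Matrix (Fin d) (Fin d) ℝ) (hH : H.IsSymm)
    (gc gtil : Fin d → ℝ) :
    let Q : Matrix (Fin d) (Fin d) ℝ := H * M
    let G : Matrix (Fin d) (Fin d) ℝ := (Qᵀ + Q) - Mᵀ * H * M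
    let gn : Fin d → ℝ := gc - M *ᵥ (gc - gtil)
    ∀ g : Fin d → ℝ,
      (g - gtil) ⬝ᵥ Q *ᵥ (gc - gtil)
        = (1 / 2) * ((g - gn) ⬝ᵥ H *ᵥ (g - gn) - (g - gc) ⬝ᵥ H *ᵥ (g - gc))
          + (1 / 2) * ((gc - gtil) ⬝ᵥ G *ᵥ (gc - gtil)) := by
  intro Q G gn g
  have symm : ∀ x y : Fin d → ℝ, x ⬝ᵥ H *ᵥ y = y ⬝ᵥ H *ᵥ x := by
    intro x y
    rw [dotProduct_mulVec, ← mulVec_transpose, hH.eq, dotProduct_comm]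
  have tr : ∀ x y : Fin d → ℝ, x ⬝ᵥ Mᵀ *ᵥ y = (M *ᵥ x) ⬝ᵥ y := by
    intro x y
    rw [dotProduct_mulVec, vecMul_transpose]
  obtain ⟨u, hu⟩ : ∃ u, u = gc - gtil := ⟨_, rfl⟩
  obtain ⟨w, hw⟩ : ∃ w, w = g - gc := ⟨_, rfl⟩
  have h1 : g - gtil = w + u := by rw [hu, hw]; abel
  have h2 : g - gn = w + M *ᵥ u := by
    simp only [gn]
    rw [hu, hw]; abel
  rw [h2, h1, ← hu, ← hw]
  simp only [Q, G, transpose_mul, hH.eq, sub_mulVec, add_mulVec, ← mulVec_mulVec, mulVec_add,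
    dotProduct_add, add_dotProduct, dotProduct_sub, tr]
  rw [symm (M *ᵥ u) w, symm (M *ᵥ u) u]
  ring
end

section
/- (Proposition A.1, contraction of QPADM-slack with Gaussian back substitution.) Let H ∈ ℝ^{d×d} be symmetric positive definite and M ∈ ℝ^{d×d} be any matrix; set Q := H M and G := (Qᵀ + Q) − Mᵀ H M. Let (g^k)_{k≥0} and (g̃^k)_{k≥0} be sequences in ℝ^d satisfying the correction step g^{k+1} = g^k − M(g^k − g̃^k) for all k, and let g* ∈ ℝ^d satisfy (g̃^k − g*)ᵀ Q (g^k − g̃^k) ≥ 0 for all k. Then for every k: ‖g^{k+1} − g*‖²_H ≤ ‖g^k − g*‖²_H − ‖g^k − g̃^k‖²_G. -/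
open Matrix

/-- Proposition A.1 (contraction of QPADM-slack with Gaussian back substitution):
with `H` symmetric positive definite, `Q := H M`, `G := (Qᵀ + Q) − Mᵀ H M`,
correction step `g^{k+1} = g^k − M (g^k − g̃^k)`, and
`(g̃^k − g*)ᵀ Q (g^k − g̃^k) ≥ 0` for all `k`, one has
`‖g^{k+1} − g*‖²_H ≤ ‖g^k − g*‖²_H − ‖g^k − g̃^k‖²_G`. -/
theorem stmt_9 {d : ℕ} (H M : Matrix (Fin d) (Fin d) ℝ) (hH : H.PosDef)
    (g gtil : ℕ → (Fin d → ℝ)) (gstar : Fin d → ℝ)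
    (hcorr : ∀ k, g (k + 1) = g k - M *ᵥ (g k - gtil k))
    (hvi : ∀ k, 0 ≤ (gtil k - gstar) ⬝ᵥ (H * M) *ᵥ (g k - gtil k)) :
    let Q : Matrix (Fin d) (Fin d) ℝ := H * M
    let G : Matrix (Fin d) (Fin d) ℝ := (Qᵀ + Q) - Mᵀ * H * M
    ∀ k, (g (k + 1) - gstar) ⬝ᵥ H *ᵥ (g (k + 1) - gstar)
      ≤ (g k - gstar) ⬝ᵥ H *ᵥ (g k - gstar)
        - (g k - gtil k) ⬝ᵥ G *ᵥ (g k - gtil k) := by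
  intro Q G k
  have hs : ∀ x y : Fin d → ℝ, x ⬝ᵥ H *ᵥ y = y ⬝ᵥ H *ᵥ x := by
    intro x y
    have hT : Hᵀ = H := by simpa [Matrix.IsSymm] using hH.isHermitian
    rw [dotProduct_mulVec, ← mulVec_transpose, hT, dotProduct_comm]
  have hv := hvi k
  obtain ⟨e, he⟩ : ∃ e, e = g k - gtil k := ⟨_, rfl⟩
  obtain ⟨t, ht⟩ : ∃ t, t = gtil k - gstar := ⟨_, rfl⟩
  obtain ⟨m, hm⟩ : ∃ m, m = M *ᵥ e := ⟨_, rfl⟩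
  have h1 : g (k + 1) - gstar = t + e - m := by
    rw [hcorr, hm, he, ht]; abel
  have h2 : g k - gstar = t + e := by
    rw [he, ht]; abel
  have hG : e ⬝ᵥ G *ᵥ e = 2 * (e ⬝ᵥ H *ᵥ m) - m ⬝ᵥ H *ᵥ m := by
    have a1 : e ⬝ᵥ (H * M)ᵀ *ᵥ e = e ⬝ᵥ H *ᵥ m := by
      rw [mulVec_transpose, dotProduct_comm, ← dotProduct_mulVec, ← mulVec_mulVec, hm]
    have a2 : e ⬝ᵥ (Mᵀ * H * M) *ᵥ e = m ⬝ᵥ H *ᵥ m := by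
      rw [← mulVec_mulVec, ← mulVec_mulVec, ← hm, dotProduct_mulVec, vecMul_transpose, ← hm]
    have a3 : e ⬝ᵥ (H * M) *ᵥ e = e ⬝ᵥ H *ᵥ m := by
      rw [← mulVec_mulVec, hm]
    simp only [G, Q, sub_mulVec, add_mulVec, dotProduct_sub, dotProduct_add, a1, a2, a3]
    ring
  rw [← he, ← ht, ← mulVec_mulVec, ← hm] at hv
  rw [h1, h2, ← he, hG]
  simp only [mulVec_sub, mulVec_add, dotProduct_sub, dotProduct_add, sub_dotProduct,
    add_dotProduct]
  rw [hs m t, hs m e]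
  linarith
end

section
/- (Proposition A.2.) Let H ∈ ℝ^{d×d} be symmetric and M ∈ ℝ^{d×d} be any matrix; set Q := H M and G := (Qᵀ + Q) − Mᵀ H M, and assume G is positive semidefinite. Let (g^k)_{k≥0} and (g̃^k)_{k≥0} be sequences in ℝ^d satisfying the correction step g^{k+1} = g^k − M(g^k − g̃^k) for all k. Fix k and suppose (g̃^k − g̃^{k+1})ᵀ Q [ (g^k − g̃^k) − (g^{k+1} − g̃^{k+1}) ] ≥ 0. Then ‖g^{k+1} − g^{k+2}‖²_H ≤ ‖g^k − g^{k+1}‖²_H. -/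
open Matrix

/-- Proposition A.2: with `H` symmetric, `Q := H M`, `G := (Qᵀ + Q) − Mᵀ H M`
positive semidefinite, correction step `g^{k+1} = g^k − M (g^k − g̃^k)`, and the
sign condition `(g̃^k − g̃^{k+1})ᵀ Q [(g^k − g̃^k) − (g^{k+1} − g̃^{k+1})] ≥ 0`,
one has `‖g^{k+1} − g^{k+2}‖²_H ≤ ‖g^k − g^{k+1}‖²_H`. -/
theorem stmt_10 {d : ℕ} (H M : Matrix (Fin d) (Fin d) ℝ) (hH : H.IsSymm)
    (hG : (((H * M)ᵀ + H * M) - Mᵀ * H * M).PosSemidef)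
    (g gtil : ℕ → (Fin d → ℝ))
    (hcorr : ∀ k, g (k + 1) = g k - M *ᵥ (g k - gtil k))
    (k : ℕ)
    (hsign : 0 ≤ (gtil k - gtil (k + 1)) ⬝ᵥ (H * M) *ᵥ
      ((g k - gtil k) - (g (k + 1) - gtil (k + 1)))) :
    (g (k + 1) - g (k + 2)) ⬝ᵥ H *ᵥ (g (k + 1) - g (k + 2))
      ≤ (g k - g (k + 1)) ⬝ᵥ H *ᵥ (g k - g (k + 1)) := by
  have symm : ∀ x y : Fin d → ℝ, x ⬝ᵥ H *ᵥ y = y ⬝ᵥ H *ᵥ x := by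
    intro x y
    rw [dotProduct_mulVec, ← mulVec_transpose, hH.eq, dotProduct_comm]
  obtain ⟨a, ha⟩ : ∃ a, a = g k - gtil k := ⟨_, rfl⟩
  obtain ⟨e, he⟩ : ∃ e, e = (g k - gtil k) - (g (k + 1) - gtil (k + 1)) := ⟨_, rfl⟩
  have h1 : g k - g (k + 1) = M *ᵥ a := by rw [hcorr k, ha]; abel
  have h2 : g (k + 1) - g (k + 2) = M *ᵥ a - M *ᵥ e := by
    rw [hcorr (k + 1), ← mulVec_sub, sub_sub_cancel]
    congr 1
    rw [ha, he]; abel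
  have h3 : gtil k - gtil (k + 1) = M *ᵥ a - e := by
    rw [← h1, he]; abel
  have h4 := hG.dotProduct_mulVec_nonneg e
  have h5 : e ⬝ᵥ (H * M)ᵀ *ᵥ e = e ⬝ᵥ H *ᵥ (M *ᵥ e) := by
    rw [mulVec_transpose, dotProduct_comm, ← dotProduct_mulVec, mulVec_mulVec]
  have h6 : e ⬝ᵥ (Mᵀ * H * M) *ᵥ e = (M *ᵥ e) ⬝ᵥ H *ᵥ (M *ᵥ e) := by
    rw [Matrix.mul_assoc, ← mulVec_mulVec, mulVec_transpose, dotProduct_comm,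
      ← dotProduct_mulVec, dotProduct_comm, ← mulVec_mulVec, dotProduct_comm, dotProduct_comm]
  rw [star_trivial, sub_mulVec, add_mulVec, dotProduct_sub, dotProduct_add, h5, h6,
    ← mulVec_mulVec] at h4
  rw [← he, h3, ← mulVec_mulVec, sub_dotProduct] at hsign
  rw [h1, h2, mulVec_sub, sub_dotProduct, dotProduct_sub, dotProduct_sub,
    symm (M *ᵥ e) (M *ᵥ a)]
  linarith
end

section
/- (Strengthened form of Proposition A.2.) Let H ∈ ℝ^{d×d} be symmetric and M ∈ ℝ^{d×d} be any matrix; set Q := H M and G := (Qᵀ + Q) − Mᵀ H M. Let (g^k)_{k≥0} and (g̃^k)_{k≥0} be sequences in ℝ^d satisfying the correction step g^{k+1} = g^k − M(g^k − g̃^k) for all k. Fix k and suppose (g̃^k − g̃^{k+1})ᵀ Q [ (g^k − g̃^k) − (g^{k+1} − g̃^{k+1}) ] ≥ 0. Then ‖g^k − g^{k+1}‖²_H − ‖g^{k+1} − g^{k+2}‖²_H ≥ ‖(g^k − g̃^k) − (g^{k+1} − g̃^{k+1})‖²_G. -/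
open Matrix

/-- Strengthened form of Proposition A.2: with `H` symmetric, `Q := H M`,
`G := (Qᵀ + Q) − Mᵀ H M`, correction step `g^{k+1} = g^k − M (g^k − g̃^k)`, and
the sign condition `(g̃^k − g̃^{k+1})ᵀ Q [(g^k − g̃^k) − (g^{k+1} − g̃^{k+1})] ≥ 0`,
one has
`‖g^k − g^{k+1}‖²_H − ‖g^{k+1} − g^{k+2}‖²_H ≥ ‖(g^k − g̃^k) − (g^{k+1} − g̃^{k+1})‖²_G`. -/
theorem stmt_19 {d : ℕ} (H M : Matrix (Fin d) (Fin d) ℝ) (hH : H.IsSymm)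
    (g gtil : ℕ → (Fin d → ℝ))
    (hcorr : ∀ k, g (k + 1) = g k - M *ᵥ (g k - gtil k))
    (k : ℕ)
    (hsign : 0 ≤ (gtil k - gtil (k + 1)) ⬝ᵥ (H * M) *ᵥ
      ((g k - gtil k) - (g (k + 1) - gtil (k + 1)))) :
    let Q : Matrix (Fin d) (Fin d) ℝ := H * M
    let G : Matrix (Fin d) (Fin d) ℝ := (Qᵀ + Q) - Mᵀ * H * M
    ((g k - gtil k) - (g (k + 1) - gtil (k + 1))) ⬝ᵥ G *ᵥ
        ((g k - gtil k) - (g (k + 1) - gtil (k + 1)))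
      ≤ (g k - g (k + 1)) ⬝ᵥ H *ᵥ (g k - g (k + 1))
        - (g (k + 1) - g (k + 2)) ⬝ᵥ H *ᵥ (g (k + 1) - g (k + 2)) := by
  intro Q G
  obtain ⟨a, ha⟩ : ∃ a, a = g k - gtil k := ⟨_, rfl⟩
  obtain ⟨b, hb⟩ : ∃ b, b = g (k + 1) - gtil (k + 1) := ⟨_, rfl⟩
  obtain ⟨w, hw⟩ : ∃ w, w = a - b := ⟨_, rfl⟩
  have h1 : g k - g (k + 1) = M *ᵥ a := by
    rw [hcorr k, ← ha]; abel
  have h2 : g (k + 1) - g (k + 2) = M *ᵥ a - M *ᵥ w := by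
    rw [hcorr (k + 1), ← hb, hw, mulVec_sub]; abel
  have h3 : gtil k - gtil (k + 1) = M *ᵥ a - w := by
    rw [← h1, hw, ha, hb]; abel
  have hsymm : ∀ x y : Fin d → ℝ, x ⬝ᵥ H *ᵥ y = y ⬝ᵥ H *ᵥ x := by
    intro x y
    rw [dotProduct_mulVec, ← mulVec_transpose, hH.eq, dotProduct_comm]
  have hG : w ⬝ᵥ G *ᵥ w = 2 * (w ⬝ᵥ H *ᵥ (M *ᵥ w)) - (M *ᵥ w) ⬝ᵥ H *ᵥ (M *ᵥ w) := by
    have e1 : w ⬝ᵥ Qᵀ *ᵥ w = w ⬝ᵥ H *ᵥ (M *ᵥ w) := by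
      rw [mulVec_transpose, dotProduct_comm, ← dotProduct_mulVec, mulVec_mulVec]
    have e2 : w ⬝ᵥ (Mᵀ * H * M) *ᵥ w = (M *ᵥ w) ⬝ᵥ H *ᵥ (M *ᵥ w) := by
      rw [← mulVec_mulVec, ← mulVec_mulVec, dotProduct_mulVec, vecMul_transpose]
    have e3 : w ⬝ᵥ Q *ᵥ w = w ⬝ᵥ H *ᵥ (M *ᵥ w) := by
      rw [mulVec_mulVec]
    simp only [G, sub_mulVec, add_mulVec, dotProduct_sub, dotProduct_add]
    rw [e1, e2, e3]; ring
  rw [← ha, ← hb, ← hw, h3, ← mulVec_mulVec, sub_dotProduct] at hsign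
  rw [← ha, ← hb, ← hw, h1, h2, hG]
  simp only [mulVec_sub H, dotProduct_sub, sub_dotProduct]
  have := hsymm (M *ᵥ a) (M *ᵥ w)
  linarith
end
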